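/- Let A be an integral domain which is a finitely generated algebra over the field of complex numbers ℂ. Then the quotient Aˣ/ℂˣ of the group of units of A by the subgroup of nonzero constants is a finitely generated free abelian group. -/

import Mathlib

open scoped WithZero

/-- A quotient of a commutative group by the kernel of a map to `ℤ^ι` is `ℤⁿ`. -/
theorem quot_ker_free {G ι : Type*} [CommGroup G] [Finite ι] (N : Subgroup G)
    (φ : G →* (ι → Multiplicative ℤ)) (h : φ.ker = N) :
    ∃ n : ℕ, Nonempty ((G ⧸ N) ≃* Multiplicative (Fin n → ℤ)) := by
  subst h
  have := Fintype.ofFinite ι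
  let e : (ι → Multiplicative ℤ) →* Multiplicative (ι → ℤ) :=
    { toFun := fun f => Multiplicative.ofAdd (fun i => (f i).toAdd)
      map_one' := rfl
      map_mul' := fun _ _ => rfl }
  have he : Function.Injective e := by
    intro f g hfg
    funext i
    exact congrFun (congrArg Multiplicative.toAdd hfg) i
  let f : (G ⧸ φ.ker) →* Multiplicative (ι → ℤ) := e.comp (QuotientGroup.kerLift φ)
  have hf : Function.Injective f := he.comp (QuotientGroup.kerLift_injective φ)
  let ψ : Additive (G ⧸ φ.ker) →+ (ι → ℤ) := MonoidHom.toAdditiveLeft f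
  have hψ : Function.Injective ψ := hf
  let ψl : Additive (G ⧸ φ.ker) →ₗ[ℤ] (ι → ℤ) := ψ.toIntLinearMap
  have hψl : Function.Injective ψl := hψ
  have eqv := LinearEquiv.ofInjective ψl hψl
  have : Module.Free ℤ (Additive (G ⧸ φ.ker)) := Module.Free.of_equiv eqv.symm
  have : Module.Finite ℤ (Additive (G ⧸ φ.ker)) := Module.Finite.equiv eqv.symm
  refine ⟨Module.finrank ℤ (Additive (G ⧸ φ.ker)), ⟨?_⟩⟩
  exact AddEquiv.toMultiplicativeRight
    (Module.finBasis ℤ (Additive (G ⧸ φ.ker))).equivFun.toAddEquiv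

/-- Homs from `ℂˣ` to `ℤ` are trivial. -/
theorem complex_units_hom_trivial (f : ℂˣ →* Multiplicative ℤ) (z : ℂˣ) : f z = 1 := by
  set a : ℤ := (f z).toAdd with ha
  obtain ⟨w, hw⟩ := IsAlgClosed.exists_pow_nat_eq (z : ℂ) (n := a.natAbs + 1) (by omega)
  have hw0 : w ≠ 0 := by
    rintro rfl
    rw [zero_pow (by omega)] at hw
    exact z.ne_zero hw.symm
  have hz : z = (Units.mk0 w hw0) ^ (a.natAbs + 1) := by
    ext; simp [hw]
  have h2 : a = ((a.natAbs + 1 : ℕ) : ℤ) * (f (Units.mk0 w hw0)).toAdd := by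
    conv_lhs => rw [ha, hz, map_pow, toAdd_pow]
    simp
  have h3 : a = 0 := by
    apply Int.eq_zero_of_abs_lt_dvd (m := ((a.natAbs + 1 : ℕ) : ℤ)) ⟨_, h2⟩
    rw [Int.abs_eq_natAbs]
    omega
  exact Multiplicative.toAdd.injective h3

/-- The finitely many extensions of a discrete valuation to a finite extension. -/
theorem exists_val_hom {K L : Type*} [Field K] [Field L] [CharZero K] [Algebra K L]
    [FiniteDimensional K L] (v : Valuation K ℤᵐ⁰) (x : K) (hx0 : x ≠ 0) (hx : v x ≠ 1) :
    ∃ (m : ℕ) (φ : Lˣ →* (Fin m → Multiplicative ℤ)),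
      ∀ u : Lˣ, φ u = 1 → IsIntegral v.valuationSubring (u : L) := by
  have : v.IsNontrivial := ⟨⟨x, by simpa using hx0, hx⟩⟩
  have hdvr : IsDiscreteValuationRing v.valuationSubring := by
    infer_instance
  let B := integralClosure v.valuationSubring L
  have : IsDedekindDomain B := integralClosure.isDedekindDomain v.valuationSubring K L
  have : IsFractionRing B L :=
    integralClosure.isFractionRing_of_finite_extension K L
  have : Finite (IsDedekindDomain.HeightOneSpectrum B) := by
    obtain ⟨π, hπ⟩ := IsDiscreteValuationRing.exists_irreducible v.valuationSubring
    have hinj : Function.Injective (algebraMap v.valuationSubring B) := by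
      intro a b hab
      have h1 : algebraMap K L (a : K) = algebraMap K L (b : K) := congrArg Subtype.val hab
      exact Subtype.ext ((algebraMap K L).injective h1)
    have hI : Ideal.span {algebraMap v.valuationSubring B π} ≠ 0 := by
      intro h
      rw [Ideal.zero_eq_bot, Ideal.span_singleton_eq_bot] at h
      exact hπ.ne_zero (hinj (h.trans (map_zero _).symm))
    have := Ideal.finite_factors hI
    rw [← Set.finite_univ_iff]
    refine this.subset fun P _ => ?_
    change P.asIdeal ∣ _
    rw [Ideal.dvd_span_singleton]
    have hm := P.isMaximal
    have hmax := Ideal.isMaximal_comap_of_isIntegral_of_isMaximal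
      (R := v.valuationSubring) P.asIdeal
    have := IsLocalRing.eq_maximalIdeal hmax
    have hmem : π ∈ IsLocalRing.maximalIdeal v.valuationSubring := hπ.not_isUnit
    rw [← this] at hmem
    exact hmem
  obtain ⟨m, ⟨e⟩⟩ := Finite.exists_equiv_fin (IsDedekindDomain.HeightOneSpectrum B)
  refine ⟨m, MonoidHom.pi fun i => (e.symm i).valuationOfNeZero (K := L), fun u hu => ?_⟩
  obtain ⟨b, hb⟩ := IsDedekindDomain.HeightOneSpectrum.mem_integers_of_valuation_le_one
    (R := B) L (u : L) (fun P => by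
      have h1 : (e.symm (e P)).valuationOfNeZero u = 1 := congrFun hu (e P)
      rw [Equiv.symm_apply_apply] at h1
      rw [← IsDedekindDomain.HeightOneSpectrum.valuationOfNeZero_eq, h1]
      simp)
  rw [← hb]
  exact b.2

/-- The degree valuation on polynomials. -/
noncomputable def degVal (d : ℕ) : Valuation (MvPolynomial (Fin d) ℂ) ℤᵐ⁰ where
  toFun p := by
    classical
    exact if p = 0 then 0 else WithZero.exp (p.totalDegree : ℤ)
  map_zero' := by simp
  map_one' := by simp
  map_mul' p q := by
    by_cases hp : p = 0
    · simp [hp]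
    by_cases hq : q = 0
    · simp [hq]
    simp [hp, hq, MvPolynomial.totalDegree_mul_of_isDomain hp hq, WithZero.exp_add]
  map_add_le_max' p q := by
    by_cases hp : p = 0
    · simp [hp]
    by_cases hq : q = 0
    · simp [hq]
    by_cases hpq : p + q = 0
    · simp [hpq]
    have := MvPolynomial.totalDegree_add p q
    simp only [hp, hq, hpq, if_false, le_max_iff, WithZero.exp_le_exp] at this ⊢
    exact_mod_cast this

theorem degVal_apply {d : ℕ} {p : MvPolynomial (Fin d) ℂ} (hp : p ≠ 0) :
    degVal d p = WithZero.exp (p.totalDegree : ℤ) := by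
  change (if p = 0 then 0 else WithZero.exp (p.totalDegree : ℤ)) = _
  simp [hp]

theorem degVal_le_one {d : ℕ} {p : MvPolynomial (Fin d) ℂ} (hp : degVal d p ≤ 1) :
    ∃ c, p = MvPolynomial.C c := by
  by_cases h0 : p = 0
  · exact ⟨0, by simp [h0]⟩
  rw [degVal_apply h0, ← WithZero.exp_zero, WithZero.exp_le_exp] at hp
  exact ⟨_, MvPolynomial.totalDegree_eq_zero_iff_eq_C.1 (by omega)⟩

/-- An element integral over `ℂ` in a domain is a constant. -/
theorem const_of_integral {A : Type*} [CommRing A] [IsDomain A] [Algebra ℂ A] (u : A)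
    (hu : IsIntegral ℂ u) : ∃ c : ℂ, algebraMap ℂ A c = u := by
  have h := IsAlgClosed.degree_eq_one_of_irreducible ℂ (minpoly.irreducible hu)
  exact minpoly.mem_range_of_degree_eq_one ℂ u h

theorem const_of_coeff {A : Type*} {d : ℕ} [CommRing A] [IsDomain A] [Algebra ℂ A]
    [Algebra (MvPolynomial (Fin d) ℂ) A] [IsScalarTower ℂ (MvPolynomial (Fin d) ℂ) A] (u : A)
    (hu : IsIntegral (MvPolynomial (Fin d) ℂ) u)
    (h : ∀ i, ∃ c, (minpoly (MvPolynomial (Fin d) ℂ) u).coeff i = MvPolynomial.C c) :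
    ∃ c : ℂ, algebraMap ℂ A c = u := by
  apply const_of_integral
  have hl : minpoly (MvPolynomial (Fin d) ℂ) u ∈
      Polynomial.lifts (algebraMap ℂ (MvPolynomial (Fin d) ℂ)) := by
    rw [Polynomial.lifts_iff_coeff_lifts]
    intro i
    obtain ⟨c, hc⟩ := h i
    exact ⟨c, hc.symm⟩
  obtain ⟨q, hq, -, hm⟩ := Polynomial.lifts_and_degree_eq_and_monic hl (minpoly.monic hu)
  refine ⟨q, hm, ?_⟩
  have := minpoly.aeval (MvPolynomial (Fin d) ℂ) u
  rw [← hq, Polynomial.aeval_map_algebraMap] at this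
  exact this

/-- Let `A` be an integral domain which is a finitely generated `ℂ`-algebra.  Then the
quotient `Aˣ/ℂˣ` of the group of units of `A` by the subgroup of nonzero constants is a
finitely generated free abelian group, i.e. isomorphic to `ℤⁿ` for some `n`. -/
theorem units_quotient_const_finite_free
    (A : Type*) [CommRing A] [IsDomain A] [Algebra ℂ A] [Algebra.FiniteType ℂ A] :
    ∃ n : ℕ, Nonempty
      ((Aˣ ⧸ (Units.map (algebraMap ℂ A : ℂ →* A)).range) ≃*
        Multiplicative (Fin n → ℤ)) := by
  suffices H : ∃ (m : ℕ) (φ : Aˣ →* (Fin m → Multiplicative ℤ)),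
      ∀ u : Aˣ, φ u = 1 → ∃ c : ℂ, algebraMap ℂ A c = u by
    obtain ⟨m, φ, hφ⟩ := H
    refine quot_ker_free _ φ (le_antisymm ?_ ?_)
    · intro u hu
      obtain ⟨c, hc⟩ := hφ u hu
      have hc0 : c ≠ 0 := by
        rintro rfl
        rw [map_zero] at hc
        exact u.ne_zero hc.symm
      exact ⟨Units.mk0 c hc0, by ext; simpa using hc⟩
    · rintro _ ⟨z, rfl⟩
      rw [MonoidHom.mem_ker]
      funext i
      exact complex_units_hom_trivial
        (((Pi.evalMonoidHom _ i).comp φ).comp (Units.map (algebraMap ℂ A : ℂ →* A))) z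
  obtain ⟨d, g, hg, hfin⟩ := exists_finite_inj_algHom_of_fg ℂ A
  let P := MvPolynomial (Fin d) ℂ
  letI : Algebra P A := g.toRingHom.toAlgebra
  have : IsScalarTower ℂ P A := IsScalarTower.of_algebraMap_eq fun c => (g.commutes c).symm
  have hinj : Function.Injective (algebraMap P A) := hg
  have : FaithfulSMul P A := (faithfulSMul_iff_algebraMap_injective P A).2 hinj
  have : Module.Finite P A := hfin
  have : Algebra.IsIntegral P A := inferInstance
  have hint : ∀ u : A, IsIntegral P u := fun u => Algebra.IsIntegral.isIntegral u
  rcases Nat.eq_zero_or_pos d with hd | hd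
  · subst hd
    refine ⟨0, 1, fun u _ => const_of_coeff (d := 0) (u : A) (hint u) fun i => ?_⟩
    exact ⟨_, MvPolynomial.eq_C_of_isEmpty _⟩
  let K := FractionRing P
  let L := FractionRing A
  letI : Algebra K L := FractionRing.liftAlgebra P L
  have : IsScalarTower P K L := inferInstance
  have : FiniteDimensional K L := inferInstance
  have : CharZero K := inferInstance
  let v : Valuation K ℤᵐ⁰ := (degVal d).extendToLocalization (S := nonZeroDivisors P)
    (by
      intro p hp hp'
      have h0 : p ≠ 0 := nonZeroDivisors.ne_zero hp
      have : degVal d p = 0 := hp'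
      rw [degVal_apply h0] at this
      exact WithZero.exp_ne_zero this) K
  have hv : ∀ p : P, v (algebraMap P K p) = degVal d p := fun p =>
    Valuation.extendToLocalization_apply_map_apply _ _ _ _
  let X : P := MvPolynomial.X ⟨0, hd⟩
  have hX : X ≠ 0 := MvPolynomial.X_ne_zero _
  obtain ⟨m, φ, hφ⟩ := exists_val_hom (L := L) v (algebraMap P K X)
    (by simpa using hX) (by
      rw [hv, degVal_apply hX]
      simp [X])
  refine ⟨m, φ.comp (Units.map (algebraMap A L : A →* L)), fun u hu => ?_⟩
  have hi : IsIntegral v.valuationSubring (algebraMap A L u) := hφ _ hu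
  refine const_of_coeff (d := d) (u : A) (hint u) fun i => ?_
  apply degVal_le_one
  have h1 := minpoly.isIntegrallyClosed_eq_field_fractions K L (hint u)
  have h2 := minpoly.isIntegrallyClosed_eq_field_fractions' K hi
  have h3 := congrArg (fun q => q.coeff i) (h1.symm.trans h2)
  simp only [Polynomial.coeff_map] at h3
  rw [← hv, h3]
  exact ((minpoly v.valuationSubring (algebraMap A L u)).coeff i).2
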